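/- Logarithmic decay for the nonlinearly damped p-system (Theorem 6, second part): Let 1 < r < 3 and q > 0, and let (ρ,u) be a classical solution of the nonlinearly damped p-system on ℝ × [0,∞) whose initial datum (ρ₀,u₀) satisfies ρ₀ ∈ L¹(ℝ) and ∫_ℝ (log(1+|x|))^{2q} (|ρ₀(x)|² + |u₀(x)|²) dx < ∞. Then there is a constant C_q > 0, independent of time, such that for all t > 0: ‖(ρ,u)(t)‖_{L²} ≤ C_q / (log(1+t))^{q}. -/

import Mathlib

open MeasureTheory

noncomputable section

/-- Squared `L²` norm of a scalar function. -/
def sqL2 (f : ℝ → ℝ) : ℝ := ∫ x, (f x) ^ 2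

/-- Squared `H¹` norm. -/
def sqH1 (f : ℝ → ℝ) : ℝ := sqL2 f + sqL2 (deriv f)

/-- Squared `H¹` norm of a pair. -/
def sqH1pair (f g : ℝ → ℝ) : ℝ := sqH1 f + sqH1 g

/-- A classical solution of the nonlinearly damped `p`-system
`∂ₜρ + ∂ₓu = 0`, `∂ₜu + ∂ₓρ + |u|^{r−1}u = 0` on `ℝ × [0,∞)`: a smooth pair,
Schwartz in `x` locally uniformly in `t`, solving the system (time first argument). -/
structure IsPSystemSolution (r : ℝ) (ρ u : ℝ → ℝ → ℝ) : Prop where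
  smooth_rho : ContDiff ℝ (⊤ : ℕ∞) (fun p : ℝ × ℝ => ρ p.1 p.2)
  smooth_u : ContDiff ℝ (⊤ : ℕ∞) (fun p : ℝ × ℝ => u p.1 p.2)
  decay : ∀ (k m : ℕ) (T : ℝ), ∃ C : ℝ, ∀ t ∈ Set.Icc (0 : ℝ) T, ∀ x : ℝ,
      |x| ^ k * (|iteratedDeriv m (fun y => ρ t y) x| +
        |iteratedDeriv m (fun y => u t y) x|) ≤ C
  eq1 : ∀ t x : ℝ, 0 ≤ t →
      deriv (fun s => ρ s x) t + deriv (fun y => u t y) x = 0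
  eq2 : ∀ t x : ℝ, 0 ≤ t →
      deriv (fun s => u s x) t + deriv (fun y => ρ t y) x +
          |u t x| ^ (r - 1) * u t x = 0

theorem sq_le_rpow_add {r σ τ p U : ℝ} (hr : 1 < r) (hσ : 1 + 2 * σ ≤ 2 / (r - 1))
    (hτ : 1 ≤ τ) (hp : 1 ≤ p) (hσ0 : 0 ≤ σ) (hU : 0 ≤ U) :
    U ^ 2 ≤ τ * (p * U ^ (r + 1)) + τ ^ (-1 - 2 * σ) * p⁻¹ := by
  have hτ0 : 0 < τ := by linarith
  have hp0 : 0 < p := by linarith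
  have hr' : 0 < r - 1 := by linarith
  have hrem : 0 ≤ τ ^ (-1 - 2 * σ) * p⁻¹ := by positivity
  have hmain : 0 ≤ τ * (p * U ^ (r + 1)) := by positivity
  rcases hU.eq_or_lt with rfl | hU0
  · simpa using add_nonneg hmain hrem
  have hsplit : U ^ (r + 1) = U ^ (r - 1) * U ^ 2 := by
    rw [← Real.rpow_natCast U 2, ← Real.rpow_add hU0]
    congr 1
    push_cast
    ring
  by_cases h : 1 ≤ τ * p * U ^ (r - 1)
  · have : U ^ 2 ≤ τ * (p * U ^ (r + 1)) := by
      rw [hsplit]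
      nlinarith [sq_nonneg U]
    linarith
  · push Not at h
    have hτp : 0 < τ * p := by positivity
    have h1 : U ^ (r - 1) ≤ (τ * p)⁻¹ := by
      rw [← one_div, le_div_iff₀ hτp]
      linarith
    have h2 : U ^ 2 ≤ ((τ * p)⁻¹) ^ (2 / (r - 1)) := by
      have := Real.rpow_le_rpow (by positivity) h1 (show 0 ≤ 2 / (r - 1) by positivity)
      rw [← Real.rpow_mul hU, mul_div_cancel₀ _ hr'.ne'] at this
      simpa using this
    have h3 : ((τ * p)⁻¹) ^ (2 / (r - 1)) ≤ ((τ * p)⁻¹) ^ (1 + 2 * σ) :=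
      Real.rpow_le_rpow_of_exponent_ge (by positivity)
        (inv_le_one_of_one_le₀ (by nlinarith)) hσ
    have h4 : ((τ * p)⁻¹) ^ (1 + 2 * σ) = τ ^ (-1 - 2 * σ) * (p⁻¹) ^ (1 + 2 * σ) := by
      rw [mul_inv, Real.mul_rpow (by positivity) (by positivity), Real.inv_rpow hτ0.le,
        ← Real.rpow_neg hτ0.le]
      congr 2
      ring
    have h5 : (p⁻¹) ^ (1 + 2 * σ) ≤ p⁻¹ := by
      have := Real.rpow_le_rpow_of_exponent_ge (inv_pos.2 hp0) (inv_le_one_of_one_le₀ hp)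
        (show (1 : ℝ) ≤ 1 + 2 * σ by linarith)
      simpa using this
    have h6 := mul_le_mul_of_nonneg_left h5 (show 0 ≤ τ ^ (-1 - 2 * σ) by positivity)
    linarith

theorem rpow_mul_le_scaled {r ε W U : ℝ} (hr : 0 < r) (hε : 0 < ε) (hW : 0 ≤ W) (hU : 0 ≤ U) :
    W ^ r * U ≤ ε * W ^ (r + 1) + (ε⁻¹) ^ r * U ^ (r + 1) := by
  have hadd : ∀ {s : ℝ}, 0 ≤ s → s ^ (r + 1) = s ^ r * s := fun {s} hs => by
    rw [Real.rpow_add_one' hs (by linarith)]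
  rw [hadd hW, hadd hU]
  have hWr : 0 ≤ W ^ r := by positivity
  have hUr : 0 ≤ U ^ r := by positivity
  have hεr : 0 ≤ (ε⁻¹) ^ r := by positivity
  rcases le_total U (ε * W) with h | h
  · have := mul_le_mul_of_nonneg_left h hWr
    have : 0 ≤ (ε⁻¹) ^ r * (U ^ r * U) := by positivity
    nlinarith
  · have h1 : W ≤ ε⁻¹ * U := by
      rw [inv_mul_eq_div, le_div_iff₀ hε]
      linarith
    have h2 : W ^ r ≤ (ε⁻¹) ^ r * U ^ r := by
      rw [← Real.mul_rpow (by positivity) hU]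
      exact Real.rpow_le_rpow hW h1 hr.le
    have := mul_le_mul_of_nonneg_right h2 hU
    have : 0 ≤ ε * (W ^ r * W) := by positivity
    nlinarith

theorem abs_rpow_mul_self_mul_le {r s v : ℝ} (hr : 1 < r) :
    |s| ^ (r - 1) * s * v ≤ |s| ^ r * |v| := by
  calc |s| ^ (r - 1) * s * v ≤ |(|s| ^ (r - 1) * s * v)| := le_abs_self _
    _ = |s| ^ (r - 1) * |s| * |v| := by
      rw [abs_mul, abs_mul, abs_of_nonneg (by positivity : 0 ≤ |s| ^ (r - 1))]
    _ = |s| ^ r * |v| := by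
      rw [← Real.rpow_add_one' (abs_nonneg s) (by linarith)]
      congr 2
      ring

theorem weight_derivative_bound {σ y ρ u : ℝ} (hσ0 : 0 ≤ σ) (hσ : σ ≤ 1 / 16) :
    (σ * (1 + σ * y ^ 2) - 2 * σ * y ^ 2) * (ρ ^ 2 + u ^ 2) + 4 * σ * y * ρ * u
      ≤ 2 * σ * (ρ ^ 2 + u ^ 2) := by
  have h1 : 2 * y * (2 * (ρ * u)) ≤ (2 * |y|) * (ρ ^ 2 + u ^ 2) := by
    have h : |2 * (ρ * u)| ≤ ρ ^ 2 + u ^ 2 := by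
      rw [abs_le]
      constructor <;> nlinarith [sq_nonneg (ρ + u), sq_nonneg (ρ - u)]
    calc 2 * y * (2 * (ρ * u)) ≤ |2 * y * (2 * (ρ * u))| := le_abs_self _
      _ = 2 * |y| * |2 * (ρ * u)| := by rw [abs_mul, abs_mul 2 y]; norm_num
      _ ≤ _ := by gcongr
  have h2 : 1 + σ * y ^ 2 - 2 * y ^ 2 + 2 * |y| ≤ 2 := by
    rw [← sq_abs y]
    nlinarith [sq_nonneg (|y| - 2 / 3), sq_nonneg |y|, abs_nonneg y]
  have h3 : (1 + σ * y ^ 2 - 2 * y ^ 2 + 2 * |y|) * (ρ ^ 2 + u ^ 2) ≤ 2 * (ρ ^ 2 + u ^ 2) := by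
    gcongr
  nlinarith

theorem multiplier_quadratic_bound {σ ρ u ω a b : ℝ} (hσ0 : 0 ≤ σ) (hσ : σ ≤ 1) :
    2 * σ * (ρ ^ 2 + u ^ 2)
      + 4 * σ * ((1 - σ) * u * ω + u ^ 2 - b * u - ρ ^ 2 + a * ρ)
      ≤ 12 * σ * u ^ 2 + 4 * σ * ω ^ 2 + 4 * σ * (a ^ 2 + b ^ 2) := by
  have q1 : (1 - σ) * u * ω ≤ (u ^ 2 + ω ^ 2) / 2 := by
    have h : |u * ω| ≤ (u ^ 2 + ω ^ 2) / 2 := by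
      rw [abs_le]
      constructor <;> nlinarith [sq_nonneg (u + ω), sq_nonneg (u - ω)]
    calc (1 - σ) * u * ω = (1 - σ) * (u * ω) := by ring
      _ ≤ (1 - σ) * |u * ω| :=
        mul_le_mul_of_nonneg_left (le_abs_self _) (by linarith)
      _ ≤ 1 * |u * ω| := by gcongr; linarith
      _ ≤ _ := by linarith
  have q2 : (1 - σ) * u * ω + u ^ 2 - b * u - ρ ^ 2 + a * ρ + (ρ ^ 2 + u ^ 2) / 2
      ≤ 3 * u ^ 2 + ω ^ 2 + (a ^ 2 + b ^ 2) := by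
    linarith [sq_nonneg (b + u), sq_nonneg (a - ρ), sq_nonneg a, sq_nonneg b, sq_nonneg u,
      sq_nonneg ω]
  linarith [mul_le_mul_of_nonneg_left q2 hσ0]

set_option maxHeartbeats 800000 in
theorem dissipation_bound {r σ κ A τ y ρ u ω a b : ℝ} (hr : 1 < r) (hσ0 : 0 < σ)
    (hσ : σ ≤ 1 / 16) (hσm : 1 + 2 * σ ≤ 2 / (r - 1)) (hσr : 2 * σ ≤ r - 1)
    (hκ0 : 0 < κ) (hκ : κ * ((r + 1) * (8 * (r + 1)) ^ r) ≤ 1) (hσκ : 32 * σ ≤ κ)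
    (hA : 0 ≤ A) (hτ : 1 ≤ τ) (ha : |a| ≤ A * τ⁻¹ * (1 + y ^ 2)⁻¹)
    (hb : |b| ≤ A * τ⁻¹ * (1 + y ^ 2)⁻¹) :
    τ⁻¹ * ((σ * (1 + σ * y ^ 2) - 2 * σ * y ^ 2) * (ρ ^ 2 + u ^ 2) + 4 * σ * y * ρ * u)
      - 2 * (1 + σ * y ^ 2) * |u| ^ (r + 1)
      + 4 * σ * τ⁻¹ * ((1 - σ) * u * ω + u ^ 2 - b * u - ρ ^ 2 + a * ρ)
      + 4 * σ * (|u| ^ (r - 1) * u * ω)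
      + κ * ((σ - r) * (1 + σ * y ^ 2) - 2 * σ * y ^ 2) * |ω| ^ (r + 1)
      + κ * (1 + σ * y ^ 2) * (r + 1) * (|ω| ^ (r - 1) * ω * (b - u))
      ≤ (A ^ 2 + 16 + A ^ (r + 1)) * τ ^ (-2 - 2 * σ) * (1 + y ^ 2)⁻¹ := by
  have hτ0 : 0 < τ := by linarith
  set z := (1 + y ^ 2)⁻¹ with hz
  set p := 1 + σ * y ^ 2 with hpdef
  have hz0 : 0 < z := by positivity
  have hz1 : z ≤ 1 := inv_le_one_of_one_le₀ (by nlinarith [sq_nonneg y])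
  have hp : 1 ≤ p := by nlinarith [mul_nonneg hσ0.le (sq_nonneg y)]
  have hp0 : 0 < p := by linarith
  have hpz : p * z ≤ 1 := by
    rw [hz, ← div_eq_mul_inv, div_le_one (by positivity)]
    nlinarith [sq_nonneg y]
  have hpi : σ * p⁻¹ ≤ z := by
    rw [hz, ← div_eq_mul_inv, ← one_div, div_le_div_iff₀ hp0 (by positivity)]
    nlinarith [sq_nonneg y]
  set g := τ ^ (-2 - 2 * σ) with hg
  have hg0 : 0 < g := by positivity
  have hg1 : τ⁻¹ * τ ^ (-1 - 2 * σ) = g := by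
    rw [← Real.rpow_neg_one, ← Real.rpow_add hτ0, hg]
    congr 1
    ring
  set X := p * |u| ^ (r + 1) with hX
  set V := p * |ω| ^ (r + 1) with hV
  have hX0 : 0 ≤ X := by positivity
  have hV0 : 0 ≤ V := by positivity
  have young : ∀ s : ℝ, σ * (τ⁻¹ * s ^ 2) ≤ σ * (p * |s| ^ (r + 1)) + g * z := by
    intro s
    have h := sq_le_rpow_add hr hσm hτ hp hσ0.le (abs_nonneg s)
    rw [sq_abs] at h
    have h' := mul_le_mul_of_nonneg_left h (show 0 ≤ σ * τ⁻¹ by positivity)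
    have e1 : σ * τ⁻¹ * (τ * (p * |s| ^ (r + 1)) + τ ^ (-1 - 2 * σ) * p⁻¹)
        = σ * (p * |s| ^ (r + 1)) + g * (σ * p⁻¹) := by
      rw [← hg1]
      field_simp
    have := mul_le_mul_of_nonneg_left hpi hg0.le
    linarith
  have hg3 : τ⁻¹ ^ 3 ≤ g := by
    have : τ⁻¹ ^ 3 = τ ^ (-3 : ℝ) := by
      rw [inv_pow, Real.rpow_neg hτ0.le]
      norm_cast
    rw [this]
    exact Real.rpow_le_rpow_of_exponent_le hτ (by linarith)
  have hgr : τ⁻¹ ^ (r + 1) ≤ g := by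
    rw [Real.inv_rpow hτ0.le, ← Real.rpow_neg hτ0.le]
    exact Real.rpow_le_rpow_of_exponent_le hτ (by linarith)
  have hsq : ∀ s : ℝ, |s| ≤ A * τ⁻¹ * z → τ⁻¹ * s ^ 2 ≤ A ^ 2 * (g * z) := by
    intro s hs
    calc τ⁻¹ * s ^ 2 = τ⁻¹ * |s| ^ 2 := by rw [sq_abs]
      _ ≤ τ⁻¹ * (A * τ⁻¹ * z) ^ 2 := by gcongr
      _ = A ^ 2 * (τ⁻¹ ^ 3 * (z * z)) := by ring
      _ ≤ A ^ 2 * (g * (z * 1)) := by gcongr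
      _ = _ := by ring
  have hbr : p * |b| ^ (r + 1) ≤ A ^ (r + 1) * (g * z) := by
    have hz2 : z ^ (r + 1) ≤ z * z := by
      have := Real.rpow_le_rpow_of_exponent_ge hz0 hz1 (show (2 : ℝ) ≤ r + 1 by linarith)
      calc z ^ (r + 1) ≤ z ^ (2 : ℝ) := this
        _ = z * z := by norm_cast; ring
    calc p * |b| ^ (r + 1) ≤ p * (A * τ⁻¹ * z) ^ (r + 1) := by gcongr
      _ = p * (A ^ (r + 1) * τ⁻¹ ^ (r + 1) * z ^ (r + 1)) := by
        rw [Real.mul_rpow (by positivity) hz0.le, Real.mul_rpow hA (by positivity)]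
      _ ≤ p * (A ^ (r + 1) * g * (z * z)) := by gcongr
      _ = A ^ (r + 1) * g * z * (p * z) := by ring
      _ ≤ A ^ (r + 1) * g * z * 1 := by gcongr
      _ = _ := by ring
  -- the bulk energy
  have i1 := mul_le_mul_of_nonneg_left
    (weight_derivative_bound (y := y) (ρ := ρ) (u := u) hσ0.le hσ) (inv_nonneg.2 hτ0.le)
  -- the quadratic terms of the multiplier
  have i2 : 2 * σ * (ρ ^ 2 + u ^ 2)
      + 4 * σ * ((1 - σ) * u * ω + u ^ 2 - b * u - ρ ^ 2 + a * ρ)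
      ≤ 12 * σ * u ^ 2 + 4 * σ * ω ^ 2 + 4 * σ * (a ^ 2 + b ^ 2) :=
    multiplier_quadratic_bound hσ0.le (by linarith)
  have i2' := mul_le_mul_of_nonneg_left i2 (inv_nonneg.2 hτ0.le)
  -- the nonlinear multiplier term
  have i3 : |u| ^ (r - 1) * u * ω ≤ X + V := by
    have h1 := abs_rpow_mul_self_mul_le (s := u) (v := ω) hr
    have h2 := rpow_mul_le_scaled (r := r) (ε := 1) (by linarith) one_pos (abs_nonneg u)
      (abs_nonneg ω)
    simp only [inv_one, Real.one_rpow, one_mul] at h2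
    have h3 : |u| ^ (r + 1) ≤ X := le_mul_of_one_le_left (by positivity) hp
    have h4 : |ω| ^ (r + 1) ≤ V := le_mul_of_one_le_left (by positivity) hp
    linarith
  -- the Hardy term
  set ε := (8 * (r + 1))⁻¹ with hε
  have hε0 : 0 < ε := by
    have : 0 < r + 1 := by linarith
    positivity
  have hardy : ∀ s : ℝ, κ * p * (r + 1) * (|ω| ^ r * |s|) ≤ κ / 8 * V + p * |s| ^ (r + 1) := by
    intro s
    have h := rpow_mul_le_scaled (r := r) (by linarith) hε0 (abs_nonneg ω) (abs_nonneg s)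
    have hc : 0 ≤ κ * p * (r + 1) := by
      have : 0 < r + 1 := by linarith
      positivity
    have h' := mul_le_mul_of_nonneg_left h hc
    have e1 : κ * p * (r + 1) * (ε * |ω| ^ (r + 1) + (ε⁻¹) ^ r * |s| ^ (r + 1))
        = κ / 8 * V + κ * ((r + 1) * (8 * (r + 1)) ^ r) * (p * |s| ^ (r + 1)) := by
      have : r + 1 ≠ 0 := by linarith
      rw [hV, hε, inv_inv]
      field_simp
    have h2 := mul_le_mul_of_nonneg_right hκ (show 0 ≤ p * |s| ^ (r + 1) by positivity)
    linarith only [h', e1, h2]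
  have i4 : κ * p * (r + 1) * (|ω| ^ (r - 1) * ω * (b - u))
      ≤ κ / 4 * V + X + A ^ (r + 1) * (g * z) := by
    have h1 := abs_rpow_mul_self_mul_le (s := ω) (v := b - u) hr
    have h2 : |ω| ^ r * |b - u| ≤ |ω| ^ r * |b| + |ω| ^ r * |u| := by
      rw [← mul_add]
      exact mul_le_mul_of_nonneg_left (abs_sub _ _) (by positivity)
    have hc : 0 ≤ κ * p * (r + 1) := by
      have : 0 < r + 1 := by linarith
      positivity
    have h3 := mul_le_mul_of_nonneg_left (h1.trans h2) hc
    linarith only [h3, hardy b, hardy u, hbr]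
  have i5 : κ * ((σ - r) * p - 2 * σ * y ^ 2) * |ω| ^ (r + 1) ≤ -(κ / 2) * V := by
    have h1 : (σ - r) * p - 2 * σ * y ^ 2 ≤ -(1 / 2) * p := by
      have h0 : (1 / 2 + σ - r) * p ≤ 0 :=
        mul_nonpos_of_nonpos_of_nonneg (by linarith) hp0.le
      linarith only [h0, mul_nonneg hσ0.le (sq_nonneg y)]
    have h2 := mul_le_mul_of_nonneg_left h1 (show 0 ≤ κ * |ω| ^ (r + 1) by positivity)
    rw [hV]
    linarith only [h2]
  have yu := young u
  have yω := young ω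
  have sa := mul_le_mul_of_nonneg_left (hsq a ha) hσ0.le
  have sb := mul_le_mul_of_nonneg_left (hsq b hb) hσ0.le
  have hgz : 0 ≤ A ^ 2 * (g * z) := by positivity
  have hσgz : σ * (A ^ 2 * (g * z)) ≤ 1 / 16 * (A ^ 2 * (g * z)) := by gcongr
  have i3' := mul_le_mul_of_nonneg_left i3 hσ0.le
  have hσX : σ * X ≤ 1 / 16 * X := by gcongr
  have hσV : 32 * σ * V ≤ κ * V := by gcongr
  have hκV : 0 ≤ κ * V := by positivity
  linarith only [i1, i2', i3', i4, i5, yu, yω, sa, sb, hgz, hσgz, hσX, hσV, hκV, hX0]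

theorem energy_density_lower_bound {r σ κ τ y ρ u ω : ℝ} (hr : 1 < r) (hσ0 : 0 < σ)
    (hσ : σ ≤ 1 / 16) (hσm : 1 + 2 * σ ≤ 2 / (r - 1)) (hσκ : 32 * σ ≤ κ) (hτ : 1 ≤ τ) :
    1 / 2 * (ρ ^ 2 + u ^ 2) - 2 * τ ^ (-1 - 2 * σ) * (1 + y ^ 2)⁻¹
      ≤ (1 + σ * y ^ 2) * (ρ ^ 2 + u ^ 2) - 4 * σ * (u * ω)
        + κ * τ * (1 + σ * y ^ 2) * |ω| ^ (r + 1) := by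
  have hτ0 : 0 < τ := by linarith
  set p := 1 + σ * y ^ 2 with hpdef
  have hp : 1 ≤ p := by nlinarith [mul_nonneg hσ0.le (sq_nonneg y)]
  have hp0 : 0 < p := by linarith
  have hpi : σ * p⁻¹ ≤ (1 + y ^ 2)⁻¹ := by
    rw [← div_eq_mul_inv, ← one_div, div_le_div_iff₀ hp0 (by positivity)]
    nlinarith [sq_nonneg y]
  have h := sq_le_rpow_add hr hσm hτ hp hσ0.le (abs_nonneg ω)
  rw [sq_abs] at h
  have h1 := mul_le_mul_of_nonneg_left h hσ0.le
  have h2 := mul_le_mul_of_nonneg_left hpi (show 0 ≤ τ ^ (-1 - 2 * σ) by positivity)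
  have h3 : 4 * σ * (u * ω) ≤ 2 * σ * u ^ 2 + 2 * σ * ω ^ 2 := by
    nlinarith [mul_nonneg hσ0.le (sq_nonneg (u - ω))]
  have h4 : 2 * σ * u ^ 2 ≤ 1 / 2 * u ^ 2 := by gcongr; linarith
  have h5 : 1 * (ρ ^ 2 + u ^ 2) ≤ p * (ρ ^ 2 + u ^ 2) := by gcongr
  have h6 : 32 * σ * (τ * (p * |ω| ^ (r + 1))) ≤ κ * (τ * (p * |ω| ^ (r + 1))) := by gcongr
  have h7 : 0 ≤ σ * (τ * (p * |ω| ^ (r + 1))) := by positivity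
  nlinarith [sq_nonneg ρ]

/-- `|g t x| ≤ C (1 + x²)^(-a)` uniformly for `t ∈ [0, T]`. -/
def UnifDecay (T a : ℝ) (g : ℝ → ℝ → ℝ) : Prop :=
  ∃ C : ℝ, ∀ t ∈ Set.Icc (0 : ℝ) T, ∀ x : ℝ, |g t x| ≤ C * (1 + x ^ 2) ^ (-a)

namespace UnifDecay

variable {T a b : ℝ} {g h : ℝ → ℝ → ℝ}

theorem mono (hg : UnifDecay T a g) (hab : b ≤ a) : UnifDecay T b g := by
  obtain ⟨C, hC⟩ := hg
  refine ⟨|C|, fun t ht x => (hC t ht x).trans ?_⟩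
  have h1 : (1 + x ^ 2) ^ (-a) ≤ (1 + x ^ 2) ^ (-b) :=
    Real.rpow_le_rpow_of_exponent_le (by nlinarith [sq_nonneg x]) (by linarith)
  exact mul_le_mul (le_abs_self C) h1 (by positivity) (abs_nonneg C)

theorem of_le (hg : UnifDecay T a g) (hh : ∀ t ∈ Set.Icc (0 : ℝ) T, ∀ x, |h t x| ≤ |g t x|) :
    UnifDecay T a h := by
  obtain ⟨C, hC⟩ := hg
  exact ⟨C, fun t ht x => (hh t ht x).trans (hC t ht x)⟩

theorem add (hg : UnifDecay T a g) (hh : UnifDecay T a h) :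
    UnifDecay T a (fun t x => g t x + h t x) := by
  obtain ⟨C, hC⟩ := hg
  obtain ⟨D, hD⟩ := hh
  refine ⟨C + D, fun t ht x => (abs_add_le _ _).trans ?_⟩
  rw [add_mul]
  exact add_le_add (hC t ht x) (hD t ht x)

theorem neg (hg : UnifDecay T a g) : UnifDecay T a (fun t x => -g t x) :=
  hg.of_le fun t _ x => (abs_neg (g t x)).le

theorem sub (hg : UnifDecay T a g) (hh : UnifDecay T a h) :
    UnifDecay T a (fun t x => g t x - h t x) := by
  simpa only [sub_eq_add_neg] using hg.add hh.neg

theorem mul (hg : UnifDecay T a g) (hh : UnifDecay T b h) :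
    UnifDecay T (a + b) (fun t x => g t x * h t x) := by
  obtain ⟨C, hC⟩ := hg
  obtain ⟨D, hD⟩ := hh
  refine ⟨C * D, fun t ht x => ?_⟩
  rw [abs_mul, neg_add, Real.rpow_add (by positivity)]
  calc |g t x| * |h t x| ≤ (C * (1 + x ^ 2) ^ (-a)) * (D * (1 + x ^ 2) ^ (-b)) :=
        mul_le_mul (hC t ht x) (hD t ht x) (abs_nonneg _) ((abs_nonneg _).trans (hC t ht x))
    _ = _ := by ring

theorem abs_rpow {s : ℝ} (hg : UnifDecay T a g) (hs : 0 ≤ s) :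
    UnifDecay T (a * s) (fun t x => |g t x| ^ s) := by
  obtain ⟨C, hC⟩ := hg
  refine ⟨|C| ^ s, fun t ht x => ?_⟩
  have hx : (0 : ℝ) < 1 + x ^ 2 := by positivity
  have h1 : |g t x| ≤ |C| * (1 + x ^ 2) ^ (-a) :=
    (hC t ht x).trans (mul_le_mul_of_nonneg_right (le_abs_self C) (by positivity))
  rw [abs_of_nonneg (by positivity : 0 ≤ |g t x| ^ s)]
  calc |g t x| ^ s ≤ (|C| * (1 + x ^ 2) ^ (-a)) ^ s := Real.rpow_le_rpow (abs_nonneg _) h1 hs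
    _ = _ := by
      rw [Real.mul_rpow (abs_nonneg _) (by positivity), ← Real.rpow_mul hx.le]
      congr 2
      ring

theorem of_continuousOn {k : ℝ → ℝ} (hk : ContinuousOn k (Set.Icc 0 T)) :
    UnifDecay T 0 (fun t _ => k t) := by
  obtain ⟨C, hC⟩ := isCompact_Icc.exists_bound_of_continuousOn hk
  exact ⟨C, fun t ht x => by simpa using hC t ht⟩

theorem const (c : ℝ) : UnifDecay T 0 (fun _ _ => c) := of_continuousOn continuousOn_const

theorem id_snd : UnifDecay T (-1) (fun _ x => x) := by
  refine ⟨1, fun t _ x => ?_⟩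
  rw [neg_neg, Real.rpow_one, one_mul, ← sq_abs x]
  nlinarith [sq_nonneg (|x| - 1), abs_nonneg x]

theorem sq_snd : UnifDecay T (-1) (fun _ x => x ^ 2) := by
  refine ⟨1, fun t _ x => ?_⟩
  rw [neg_neg, Real.rpow_one, one_mul, abs_of_nonneg (sq_nonneg x)]
  linarith

theorem bound_one (hg : UnifDecay T 1 g) :
    ∃ C : ℝ, ∀ t ∈ Set.Icc (0 : ℝ) T, ∀ x : ℝ, ‖g t x‖ ≤ C * (1 + x ^ 2)⁻¹ := by
  simpa only [UnifDecay, Real.rpow_neg_one, Real.norm_eq_abs] using hg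

end UnifDecay

theorem tendsto_cocompact_of_bound {f : ℝ → ℝ} {C : ℝ}
    (hf : ∀ x, ‖f x‖ ≤ C * (1 + x ^ 2)⁻¹) :
    Filter.Tendsto f (Filter.cocompact ℝ) (nhds 0) := by
  have h1 : Filter.Tendsto (fun x : ℝ => 1 + x ^ 2) (Filter.cocompact ℝ) Filter.atTop := by
    refine Filter.tendsto_atTop_add_const_left _ _ ?_
    have := (tendsto_norm_cocompact_atTop (E := ℝ))
    have h2 := (Filter.tendsto_pow_atTop (α := ℝ) two_ne_zero).comp this
    refine h2.congr fun x => ?_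
    simp
  have h2 := h1.inv_tendsto_atTop.const_mul C
  rw [mul_zero] at h2
  exact squeeze_zero_norm hf h2

theorem integral_eq_zero_of_flux {f f' : ℝ → ℝ} {C D : ℝ} (hf : ∀ x, HasDerivAt f (f' x) x)
    (hc : Continuous f') (hfC : ∀ x, ‖f x‖ ≤ C * (1 + x ^ 2)⁻¹)
    (hfD : ∀ x, ‖f' x‖ ≤ D * (1 + x ^ 2)⁻¹) :
    Integrable f' ∧ ∫ x, f' x = 0 := by
  have hi : Integrable f' :=
    (integrable_inv_one_add_sq.const_mul D).mono' hc.aestronglyMeasurable (.of_forall hfD)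
  have ht := tendsto_cocompact_of_bound hfC
  refine ⟨hi, ?_⟩
  rw [integral_of_hasDerivAt_of_tendsto hf hi (ht.mono_left _root_.atBot_le_cocompact)
    (ht.mono_left _root_.atTop_le_cocompact), sub_zero]

theorem integral_inv_one_add_div_sq {τ : ℝ} (hτ : 0 < τ) :
    ∫ x : ℝ, (1 + (x / τ) ^ 2)⁻¹ = τ * Real.pi := by
  rw [Measure.integral_comp_div (g := fun x : ℝ => (1 + x ^ 2)⁻¹), integral_univ_inv_one_add_sq,
    abs_of_pos hτ, smul_eq_mul]

theorem integrable_inv_one_add_div_sq {τ : ℝ} (hτ : 0 < τ) :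
    Integrable fun x : ℝ => (1 + (x / τ) ^ 2)⁻¹ :=
  integrable_inv_one_add_sq.comp_div hτ.ne'

theorem integral_le_of_flux_bound {T σ K : ℝ} (hT : 0 ≤ T) (hσ : 0 < σ) (hK : 0 ≤ K)
    {e e' f f' : ℝ → ℝ → ℝ}
    (he : ∀ t ∈ Set.Icc 0 T, ∀ x, HasDerivAt (fun s => e s x) (e' t x) t)
    (hf : ∀ t ∈ Set.Icc 0 T, ∀ x, HasDerivAt (f t) (f' t x) x)
    (ce : ∀ t ∈ Set.Icc 0 T, Continuous (e t)) (ce' : ∀ t ∈ Set.Icc 0 T, Continuous (e' t))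
    (cf' : ∀ t ∈ Set.Icc 0 T, Continuous (f' t))
    (de : UnifDecay T 1 e) (de' : UnifDecay T 1 e') (df : UnifDecay T 1 f)
    (df' : UnifDecay T 1 f')
    (h : ∀ t ∈ Set.Icc 0 T, ∀ x,
      e' t x + f' t x ≤ K * (1 + t) ^ (-2 - σ) * (1 + (x / (1 + t)) ^ 2)⁻¹) :
    ∫ x, e T x ≤ (∫ x, e 0 x) + K * Real.pi / σ := by
  obtain ⟨Ce, de⟩ := de.bound_one
  obtain ⟨Ce', de'⟩ := de'.bound_one
  obtain ⟨Cf, df⟩ := df.bound_one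
  obtain ⟨Cf', df'⟩ := df'.bound_one
  have ie : ∀ t ∈ Set.Icc 0 T, Integrable (e t) := fun t ht =>
    (integrable_inv_one_add_sq.const_mul Ce).mono' (ce t ht).aestronglyMeasurable
      (.of_forall (de t ht))
  have ie' : ∀ t ∈ Set.Icc 0 T, Integrable (e' t) := fun t ht =>
    (integrable_inv_one_add_sq.const_mul Ce').mono' (ce' t ht).aestronglyMeasurable
      (.of_forall (de' t ht))
  have hcont : ContinuousOn (fun t => ∫ x, e t x) (Set.Icc 0 T) :=
    continuousOn_of_dominated (fun t ht => (ce t ht).aestronglyMeasurable)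
      (fun t ht => .of_forall (de t ht)) (integrable_inv_one_add_sq.const_mul Ce)
      (.of_forall fun x t ht => (he t ht x).continuousAt.continuousWithinAt)
  have hder : ∀ t ∈ Set.Ioo 0 T, HasDerivAt (fun t => ∫ x, e t x) (∫ x, e' t x) t := by
    intro t ht
    have hn : Set.Icc 0 T ∈ nhds t := Icc_mem_nhds ht.1 ht.2
    have htc := Set.Ioo_subset_Icc_self ht
    exact (hasDerivAt_integral_of_dominated_loc_of_deriv_le hn
      (Filter.eventually_of_mem hn fun s hs => (ce s hs).aestronglyMeasurable) (ie t htc)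
      (ce' t htc).aestronglyMeasurable (.of_forall fun x s hs => de' s hs x)
      (integrable_inv_one_add_sq.const_mul Ce') (.of_forall fun x s hs => he s hs x)).2
  have hle : ∀ t ∈ Set.Icc 0 T, ∫ x, e' t x ≤ K * Real.pi * (1 + t) ^ (-1 - σ) := by
    intro t ht
    have hτ : 0 < 1 + t := by linarith [ht.1]
    obtain ⟨hi, h0⟩ := integral_eq_zero_of_flux (hf t ht) (cf' t ht) (df t ht) (df' t ht)
    calc ∫ x, e' t x = ∫ x, (e' t x + f' t x) := by rw [integral_add (ie' t ht) hi, h0, add_zero]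
      _ ≤ ∫ x, K * (1 + t) ^ (-2 - σ) * (1 + (x / (1 + t)) ^ 2)⁻¹ :=
        integral_mono ((ie' t ht).add hi) ((integrable_inv_one_add_div_sq hτ).const_mul _) (h t ht)
      _ = K * Real.pi * ((1 + t) ^ (-2 - σ) * (1 + t) ^ (1 : ℝ)) := by
        rw [integral_const_mul, integral_inv_one_add_div_sq hτ, Real.rpow_one]
        ring
      _ = _ := by
        rw [← Real.rpow_add hτ]
        congr 2
        ring
  have hpow : ∀ t ∈ Set.Icc 0 T, HasDerivAt (fun t => K * Real.pi / σ * (1 + t) ^ (-σ))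
      (-(K * Real.pi * (1 + t) ^ (-1 - σ))) t := by
    intro t ht
    have hτ : 1 + t ≠ 0 := by linarith [ht.1]
    have h1 := (((hasDerivAt_id t).const_add 1).rpow_const (p := -σ) (Or.inl hτ)).const_mul
      (K * Real.pi / σ)
    refine h1.congr_deriv ?_
    rw [show -σ - 1 = -1 - σ by ring]
    simp only [id]
    field_simp
  have hanti : AntitoneOn (fun t => (∫ x, e t x) + K * Real.pi / σ * (1 + t) ^ (-σ))
      (Set.Icc 0 T) := by
    refine antitoneOn_of_deriv_nonpos (convex_Icc 0 T)
      (hcont.add fun t ht => (hpow t ht).continuousAt.continuousWithinAt) ?_ ?_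
    all_goals
      rw [interior_Icc]
      intro t ht
      have hd := (hder t ht).add (hpow t (Set.Ioo_subset_Icc_self ht))
    · exact hd.differentiableAt.differentiableWithinAt
    · have := hle t (Set.Ioo_subset_Icc_self ht)
      refine hd.deriv.trans_le ?_
      linarith
  have hfin := hanti (Set.left_mem_Icc.2 hT) (Set.right_mem_Icc.2 hT) hT
  simp only [add_zero, Real.one_rpow, mul_one] at hfin
  have : 0 ≤ K * Real.pi / σ * (1 + T) ^ (-σ) := by positivity
  linarith

theorem abs_rpow_add_one_eq {r s : ℝ} (hr : 1 < r) :
    |s| ^ (r + 1) = |s| ^ (r - 1) * s ^ 2 := by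
  rw [← sq_abs s, ← Real.rpow_natCast |s| 2, ← Real.rpow_add_of_nonneg (abs_nonneg s)
    (by linarith) (by positivity)]
  congr 1
  push_cast
  ring

/-- The Lyapunov density: weighted energy, multiplier term, and Hardy term for `ω = w / (1 + t)`. -/
def lyapunovDensity (r σ κ : ℝ) (ρ u ω : ℝ → ℝ → ℝ) (t x : ℝ) : ℝ :=
  (1 + t) ^ σ * ((1 + σ * (x / (1 + t)) ^ 2) * (ρ t x ^ 2 + u t x ^ 2)
    - 4 * σ * (u t x * ω t x)
    + κ * ((1 + t) * (1 + σ * (x / (1 + t)) ^ 2)) * |ω t x| ^ (r + 1))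

/-- The time derivative of `lyapunovDensity` in terms of those of its arguments. -/
def lyapunovRate (r σ κ : ℝ) (ρ u ω ρt ut ωt : ℝ → ℝ → ℝ) (t x : ℝ) : ℝ :=
  (1 + t) ^ σ * (σ * (1 + t)⁻¹ * ((1 + σ * (x / (1 + t)) ^ 2) * (ρ t x ^ 2 + u t x ^ 2)
    - 4 * σ * (u t x * ω t x)
    + κ * ((1 + t) * (1 + σ * (x / (1 + t)) ^ 2)) * |ω t x| ^ (r + 1))
    + (-2 * σ * (1 + t)⁻¹ * (x / (1 + t)) ^ 2 * (ρ t x ^ 2 + u t x ^ 2)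
    + (1 + σ * (x / (1 + t)) ^ 2) * (2 * (ρ t x * ρt t x) + 2 * (u t x * ut t x))
    - 4 * σ * (ut t x * ω t x + u t x * ωt t x)
    + κ * (1 - σ * (x / (1 + t)) ^ 2) * |ω t x| ^ (r + 1)
    + κ * (r + 1) * (1 + t) * ((1 + σ * (x / (1 + t)) ^ 2)
      * (|ω t x| ^ (r - 1) * ω t x * ωt t x))))

/-- The energy flux. -/
def lyapunovFlux (σ : ℝ) (ρ u ω : ℝ → ℝ → ℝ) (t x : ℝ) : ℝ :=
  (1 + t) ^ σ * (2 * ((1 + σ * (x / (1 + t)) ^ 2) * (ρ t x * u t x))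
    - 4 * σ * (ρ t x * ω t x))

/-- The space derivative of `lyapunovFlux` in terms of those of its arguments. -/
def lyapunovFluxDeriv (σ : ℝ) (ρ u ω ρx ux ωx : ℝ → ℝ → ℝ) (t x : ℝ) : ℝ :=
  (1 + t) ^ σ * (4 * σ * (1 + t)⁻¹ * (x / (1 + t)) * (ρ t x * u t x)
    + 2 * ((1 + σ * (x / (1 + t)) ^ 2) * (ρx t x * u t x + ρ t x * ux t x))
    - 4 * σ * (ρx t x * ω t x + ρ t x * ωx t x))

theorem hasDerivAt_lyapunovDensity {r σ κ t x : ℝ} {ρ u ω ρt ut ωt : ℝ → ℝ → ℝ} (hr : 1 < r)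
    (ht : 0 < 1 + t) (hρ : HasDerivAt (fun s => ρ s x) (ρt t x) t)
    (hu : HasDerivAt (fun s => u s x) (ut t x) t)
    (hω : HasDerivAt (fun s => ω s x) (ωt t x) t) :
    HasDerivAt (fun s => lyapunovDensity r σ κ ρ u ω s x)
      (lyapunovRate r σ κ ρ u ω ρt ut ωt t x) t := by
  have hτ : HasDerivAt (fun s : ℝ => 1 + s) 1 t := (hasDerivAt_id t).const_add 1
  have hpow := hτ.rpow_const (p := σ) (Or.inl ht.ne')
  have hy := ((hasDerivAt_const t x).div hτ ht.ne').pow 2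
  have hp := (hy.const_mul σ).const_add 1
  have hΩ := (hasDerivAt_abs_rpow (ω t x) (show 1 < r + 1 by linarith)).comp t hω
  have hmain := hpow.mul (((hp.mul ((hρ.pow 2).add (hu.pow 2))).sub
    ((hu.mul hω).const_mul (4 * σ))).add (((hτ.mul hp).const_mul κ).mul hΩ))
  refine hmain.congr_deriv ?_
  simp only [lyapunovRate, Pi.mul_apply, Pi.pow_apply, Pi.add_apply, Pi.sub_apply, Pi.div_apply,
    Function.comp_apply, Real.rpow_sub_one ht.ne', Nat.reduceSub, pow_one, Nat.cast_ofNat]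
  rw [show r + 1 - 2 = r - 1 by ring]
  field_simp
  ring

theorem hasDerivAt_lyapunovFlux {σ t x : ℝ} {ρ u ω ρx ux ωx : ℝ → ℝ → ℝ} (ht : 0 < 1 + t)
    (hρ : HasDerivAt (ρ t) (ρx t x) x) (hu : HasDerivAt (u t) (ux t x) x)
    (hω : HasDerivAt (ω t) (ωx t x) x) :
    HasDerivAt (lyapunovFlux σ ρ u ω t) (lyapunovFluxDeriv σ ρ u ω ρx ux ωx t x) x := by
  have hy := ((hasDerivAt_id x).div_const (1 + t)).pow 2
  have hp := (hy.const_mul σ).const_add 1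
  have hmain := (((hp.mul (hρ.mul hu)).const_mul 2).sub
    ((hρ.mul hω).const_mul (4 * σ))).const_mul ((1 + t) ^ σ)
  refine hmain.congr_deriv ?_
  simp only [lyapunovFluxDeriv, Pi.mul_apply, Pi.pow_apply, id, Nat.reduceSub, pow_one,
    Nat.cast_ofNat]
  field_simp
  ring

section Decay

variable {r σ κ T : ℝ} {ρ u ω ρ' u' ω' : ℝ → ℝ → ℝ}

namespace UnifDecay

theorem one_mul_one {g h : ℝ → ℝ → ℝ} (hg : UnifDecay T 1 g) (hh : UnifDecay T 1 h) :
    UnifDecay T 1 (fun t x => g t x * h t x) :=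
  (hg.mul hh).mono (by norm_num)

theorem bounded_mul {a : ℝ} {g h : ℝ → ℝ → ℝ} (hg : UnifDecay T 0 g) (hh : UnifDecay T a h) :
    UnifDecay T a (fun t x => g t x * h t x) :=
  (hg.mul hh).mono (zero_add a).ge

theorem sq_two {g : ℝ → ℝ → ℝ} (hg : UnifDecay T 1 g) :
    UnifDecay T 2 (fun t x => g t x ^ 2) :=
  ((hg.mul hg).mono (b := 2) (by norm_num)).of_le fun t _ x => le_of_eq (by rw [pow_two])

theorem time_rpow (s : ℝ) : UnifDecay T 0 (fun t _ => (1 + t) ^ s) :=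
  of_continuousOn <| ContinuousOn.rpow_const (by fun_prop) fun t ht =>
    Or.inl (by have := ht.1; positivity)

theorem time : UnifDecay T 0 (fun t _ => 1 + t) := of_continuousOn (by fun_prop)

theorem time_inv : UnifDecay T 0 (fun t _ => (1 + t)⁻¹) := by
  simpa only [Real.rpow_neg_one] using time_rpow (T := T) (-1)

theorem div_time : UnifDecay T (-1) (fun t x => x / (1 + t)) := by
  simpa only [div_eq_mul_inv, add_zero] using id_snd.mul (time_inv (T := T))

theorem sq_div_time : UnifDecay T (-1) (fun t x => (x / (1 + t)) ^ 2) := by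
  have h := sq_snd.mul ((time_inv (T := T)).bounded_mul time_inv)
  exact (h.mono (by norm_num)).of_le fun t _ x => le_of_eq (congrArg abs (by ring))

theorem weight (σ : ℝ) : UnifDecay T (-1) (fun t x => 1 + σ * (x / (1 + t)) ^ 2) :=
  ((const 1).mono (by norm_num)).add ((const σ).bounded_mul sq_div_time)

theorem weight_mul {a : ℝ} (σ : ℝ) {g : ℝ → ℝ → ℝ} (hg : UnifDecay T a g) (ha : 2 ≤ a) :
    UnifDecay T 1 (fun t x => (1 + σ * (x / (1 + t)) ^ 2) * g t x) :=
  ((weight σ).mul hg).mono (by linarith)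

end UnifDecay

open UnifDecay

theorem unifDecay_lyapunovBracket (hr : 1 < r) (hρ : UnifDecay T 1 ρ) (hu : UnifDecay T 1 u)
    (hω : UnifDecay T 1 ω) :
    UnifDecay T 1 (fun t x => (1 + σ * (x / (1 + t)) ^ 2) * (ρ t x ^ 2 + u t x ^ 2)
      - 4 * σ * (u t x * ω t x)
      + κ * ((1 + t) * (1 + σ * (x / (1 + t)) ^ 2)) * |ω t x| ^ (r + 1)) := by
  refine ((weight_mul σ (hρ.sq_two.add hu.sq_two) le_rfl).sub
    ((const (4 * σ)).bounded_mul (hu.one_mul_one hω))).add ?_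
  have h := (const κ).bounded_mul (time.bounded_mul
    (weight_mul σ (hω.abs_rpow (show 0 ≤ r + 1 by linarith)) (by linarith)))
  simpa only [mul_assoc] using h

theorem unifDecay_lyapunovDensity (hr : 1 < r) (hρ : UnifDecay T 1 ρ) (hu : UnifDecay T 1 u)
    (hω : UnifDecay T 1 ω) : UnifDecay T 1 (lyapunovDensity r σ κ ρ u ω) :=
  (time_rpow σ).bounded_mul (unifDecay_lyapunovBracket hr hρ hu hω)

theorem unifDecay_lyapunovRate (hr : 1 < r) (hρ : UnifDecay T 1 ρ) (hu : UnifDecay T 1 u)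
    (hω : UnifDecay T 1 ω) (hρ' : UnifDecay T 1 ρ') (hu' : UnifDecay T 1 u')
    (hω' : UnifDecay T 1 ω') : UnifDecay T 1 (lyapunovRate r σ κ ρ u ω ρ' u' ω') := by
  have hΩ := hω.abs_rpow (show 0 ≤ r + 1 by linarith)
  have hΩ' := ((hω.abs_rpow (show 0 ≤ r - 1 by linarith)).mul hω).mul hω'
  have two {g h : ℝ → ℝ → ℝ} (hg : UnifDecay T 1 g) (hh : UnifDecay T 1 h) :
      UnifDecay T 2 (fun t x => 2 * (g t x * h t x)) :=
    (const 2).bounded_mul ((hg.mul hh).mono (by norm_num))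
  refine (time_rpow σ).bounded_mul ((((const σ).bounded_mul time_inv).bounded_mul
    (unifDecay_lyapunovBracket hr hρ hu hω)).add (((((?_ : UnifDecay T 1 _).add
    (weight_mul σ ((two hρ hρ').add (two hu hu')) le_rfl)).sub
    ((const (4 * σ)).bounded_mul ((hu'.one_mul_one hω).add (hu.one_mul_one hω')))).add ?_).add
    (((const (κ * (r + 1))).bounded_mul time).bounded_mul
      (weight_mul σ hΩ' (by linarith)))))
  · exact ((((const (-2 * σ)).bounded_mul time_inv).bounded_mul sq_div_time).mul
      (hρ.sq_two.add hu.sq_two)).mono (by norm_num)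
  · have h := (const κ).bounded_mul (weight_mul (-σ) hΩ (by linarith))
    simpa only [mul_assoc, neg_mul, ← sub_eq_add_neg] using h

theorem unifDecay_lyapunovFlux (hρ : UnifDecay T 1 ρ) (hu : UnifDecay T 1 u)
    (hω : UnifDecay T 1 ω) : UnifDecay T 1 (lyapunovFlux σ ρ u ω) :=
  (time_rpow σ).bounded_mul (((const 2).bounded_mul
    (weight_mul σ ((hρ.mul hu).mono (b := 2) (by norm_num)) le_rfl)).sub
    ((const (4 * σ)).bounded_mul (hρ.one_mul_one hω)))

theorem unifDecay_lyapunovFluxDeriv (hρ : UnifDecay T 1 ρ) (hu : UnifDecay T 1 u)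
    (hω : UnifDecay T 1 ω) (hρ' : UnifDecay T 1 ρ') (hu' : UnifDecay T 1 u')
    (hω' : UnifDecay T 1 ω') : UnifDecay T 1 (lyapunovFluxDeriv σ ρ u ω ρ' u' ω') := by
  refine (time_rpow σ).bounded_mul (((?_ : UnifDecay T 1 _).add ((const 2).bounded_mul
    (weight_mul σ (a := 2) ?_ le_rfl))).sub
    ((const (4 * σ)).bounded_mul ((hρ'.one_mul_one hω).add (hρ.one_mul_one hω'))))
  · exact ((((const (4 * σ)).bounded_mul time_inv).bounded_mul div_time).mul
      (hρ.mul hu)).mono (by norm_num)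
  · exact ((hρ'.mul hu).add (hρ.mul hu')).mono (by norm_num)

end Decay

theorem lyapunovRate_add_fluxDeriv {r σ κ t x : ℝ} {ρ u ω ρx ux a b : ℝ → ℝ → ℝ} (hr : 1 < r)
    (ht : 0 < 1 + t) :
    lyapunovRate r σ κ ρ u ω (fun t x => -ux t x)
        (fun t x => -ρx t x - |u t x| ^ (r - 1) * u t x)
        (fun t x => (-u t x + b t x - ω t x) * (1 + t)⁻¹) t x
      + lyapunovFluxDeriv σ ρ u ω ρx ux (fun t x => (ρ t x - a t x) * (1 + t)⁻¹) t x
      = (1 + t) ^ σ * ((1 + t)⁻¹ * ((σ * (1 + σ * (x / (1 + t)) ^ 2)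
          - 2 * σ * (x / (1 + t)) ^ 2) * (ρ t x ^ 2 + u t x ^ 2)
          + 4 * σ * (x / (1 + t)) * ρ t x * u t x)
        - 2 * (1 + σ * (x / (1 + t)) ^ 2) * |u t x| ^ (r + 1)
        + 4 * σ * (1 + t)⁻¹ * ((1 - σ) * u t x * ω t x + u t x ^ 2 - b t x * u t x
          - ρ t x ^ 2 + a t x * ρ t x)
        + 4 * σ * (|u t x| ^ (r - 1) * u t x * ω t x)
        + κ * ((σ - r) * (1 + σ * (x / (1 + t)) ^ 2) - 2 * σ * (x / (1 + t)) ^ 2)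
          * |ω t x| ^ (r + 1)
        + κ * (1 + σ * (x / (1 + t)) ^ 2) * (r + 1)
          * (|ω t x| ^ (r - 1) * ω t x * (b t x - u t x))) := by
  simp only [lyapunovRate, lyapunovFluxDeriv, abs_rpow_add_one_eq hr]
  generalize x / (1 + t) = y
  generalize |u t x| ^ (r - 1) = G
  generalize |ω t x| ^ (r - 1) = H
  field_simp
  ring

/-- The integrated Lyapunov estimate on `[0, T]`, with a bound that does not depend on `T`. -/
theorem weighted_energy_bound {r σ κ A T : ℝ} {ρ u ω ρx ux a b : ℝ → ℝ → ℝ} (hr : 1 < r)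
    (hσ0 : 0 < σ) (hσ : σ ≤ 1 / 16) (hσm : 1 + 2 * σ ≤ 2 / (r - 1)) (hσr : 2 * σ ≤ r - 1)
    (hκ0 : 0 < κ) (hκ : κ * ((r + 1) * (8 * (r + 1)) ^ r) ≤ 1) (hσκ : 32 * σ ≤ κ)
    (hA : 0 ≤ A) (hT : 0 ≤ T)
    (hρt : ∀ t ∈ Set.Icc 0 T, ∀ x, HasDerivAt (fun s => ρ s x) (-ux t x) t)
    (hut : ∀ t ∈ Set.Icc 0 T, ∀ x,
      HasDerivAt (fun s => u s x) (-ρx t x - |u t x| ^ (r - 1) * u t x) t)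
    (hωt : ∀ t ∈ Set.Icc 0 T, ∀ x,
      HasDerivAt (fun s => ω s x) ((-u t x + b t x - ω t x) * (1 + t)⁻¹) t)
    (hρx : ∀ t ∈ Set.Icc 0 T, ∀ x, HasDerivAt (ρ t) (ρx t x) x)
    (hux : ∀ t ∈ Set.Icc 0 T, ∀ x, HasDerivAt (u t) (ux t x) x)
    (hωx : ∀ t ∈ Set.Icc 0 T, ∀ x, HasDerivAt (ω t) ((ρ t x - a t x) * (1 + t)⁻¹) x)
    (cρx : ∀ t ∈ Set.Icc 0 T, Continuous (ρx t)) (cux : ∀ t ∈ Set.Icc 0 T, Continuous (ux t))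
    (ca : ∀ t ∈ Set.Icc 0 T, Continuous (a t)) (cb : ∀ t ∈ Set.Icc 0 T, Continuous (b t))
    (dρ : UnifDecay T 1 ρ) (du : UnifDecay T 1 u) (dω : UnifDecay T 1 ω)
    (dρx : UnifDecay T 1 ρx) (dux : UnifDecay T 1 ux)
    (da : UnifDecay T 1 a) (db : UnifDecay T 1 b)
    (ha : ∀ t ∈ Set.Icc 0 T, ∀ x,
      |a t x| ≤ A * (1 + t)⁻¹ * (1 + (x / (1 + t)) ^ 2)⁻¹)
    (hb : ∀ t ∈ Set.Icc 0 T, ∀ x,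
      |b t x| ≤ A * (1 + t)⁻¹ * (1 + (x / (1 + t)) ^ 2)⁻¹) :
    1 / 2 * (1 + T) ^ σ * (sqL2 (ρ T) + sqL2 (u T))
      ≤ (∫ x, lyapunovDensity r σ κ ρ u ω 0 x)
        + (A ^ 2 + 16 + A ^ (r + 1)) * Real.pi / σ + 2 * Real.pi := by
  have hr1 : 0 ≤ r - 1 := by linarith
  have hr2 : 0 ≤ r + 1 := by linarith
  have cρ : ∀ t ∈ Set.Icc 0 T, Continuous (ρ t) := fun t ht =>
    continuous_iff_continuousAt.2 fun x => (hρx t ht x).continuousAt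
  have cu : ∀ t ∈ Set.Icc 0 T, Continuous (u t) := fun t ht =>
    continuous_iff_continuousAt.2 fun x => (hux t ht x).continuousAt
  have cω : ∀ t ∈ Set.Icc 0 T, Continuous (ω t) := fun t ht =>
    continuous_iff_continuousAt.2 fun x => (hωx t ht x).continuousAt
  have ce : ∀ t ∈ Set.Icc 0 T, Continuous (lyapunovDensity r σ κ ρ u ω t) := fun t ht => by
    have := cρ t ht
    have := cu t ht
    have := cω t ht
    have h := (this.abs).rpow_const (p := r + 1) fun x => Or.inr hr2
    unfold lyapunovDensity
    fun_prop
  have dut : UnifDecay T 1 (fun t x => -ρx t x - |u t x| ^ (r - 1) * u t x) :=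
    dρx.neg.sub (((du.abs_rpow hr1).mul du).mono (by linarith))
  have dωt : UnifDecay T 1 (fun t x => (-u t x + b t x - ω t x) * (1 + t)⁻¹) := by
    simpa using ((du.neg.add db).sub dω).mul UnifDecay.time_inv
  have dωx : UnifDecay T 1 (fun t x => (ρ t x - a t x) * (1 + t)⁻¹) := by
    simpa using (dρ.sub da).mul UnifDecay.time_inv
  have hflux := integral_le_of_flux_bound hT hσ0
    (show 0 ≤ A ^ 2 + 16 + A ^ (r + 1) by positivity)
    (fun t ht x => hasDerivAt_lyapunovDensity (κ := κ) (σ := σ) (r := r)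
      (ρt := fun t x => -ux t x) (ut := fun t x => -ρx t x - |u t x| ^ (r - 1) * u t x)
      (ωt := fun t x => (-u t x + b t x - ω t x) * (1 + t)⁻¹) hr (by linarith [ht.1])
      (hρt t ht x) (hut t ht x) (hωt t ht x))
    (fun t ht x => hasDerivAt_lyapunovFlux (σ := σ) (by linarith [ht.1])
      (ωx := fun t x => (ρ t x - a t x) * (1 + t)⁻¹)
      (hρx t ht x) (hux t ht x) (hωx t ht x))
    ce
    (fun t ht => by
      have := cρ t ht
      have := cu t ht
      have := cω t ht
      have := cρx t ht
      have := cux t ht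
      have := cb t ht
      have := ((cω t ht).abs).rpow_const (p := r + 1) fun x => Or.inr hr2
      have := ((cω t ht).abs).rpow_const (p := r - 1) fun x => Or.inr hr1
      have := ((cu t ht).abs).rpow_const (p := r - 1) fun x => Or.inr hr1
      unfold lyapunovRate
      fun_prop)
    (fun t ht => by
      have := cρ t ht
      have := cu t ht
      have := cω t ht
      have := cρx t ht
      have := cux t ht
      have := ca t ht
      unfold lyapunovFluxDeriv
      fun_prop)
    (unifDecay_lyapunovDensity hr dρ du dω)
    (unifDecay_lyapunovRate hr dρ du dω dux.neg dut dωt)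
    (unifDecay_lyapunovFlux dρ du dω)
    (unifDecay_lyapunovFluxDeriv dρ du dω dρx dux dωx)
    (fun t ht x => by
      have hτ : 0 < 1 + t := by linarith [ht.1]
      rw [lyapunovRate_add_fluxDeriv hr hτ]
      refine (mul_le_mul_of_nonneg_left (dissipation_bound hr hσ0 hσ hσm hσr hκ0 hκ hσκ hA
        (by linarith [ht.1]) (ha t ht x) (hb t ht x)) (by positivity)).trans_eq ?_
      rw [show -2 - σ = σ + (-2 - 2 * σ) by ring, Real.rpow_add hτ]
      ring)
  have hmem : T ∈ Set.Icc 0 T := Set.right_mem_Icc.2 hT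
  have hτ : 0 < 1 + T := by linarith
  obtain ⟨Cρ, hCρ⟩ := (dρ.sq_two.mono (show (1 : ℝ) ≤ 2 by norm_num)).bound_one
  obtain ⟨Cu, hCu⟩ := (du.sq_two.mono (show (1 : ℝ) ≤ 2 by norm_num)).bound_one
  obtain ⟨Ce, hCe⟩ := (unifDecay_lyapunovDensity (σ := σ) (κ := κ) hr dρ du dω).bound_one
  have iρ : Integrable (fun x => ρ T x ^ 2) :=
    (integrable_inv_one_add_sq.const_mul Cρ).mono' ((cρ T hmem).pow 2).aestronglyMeasurable
      (.of_forall (hCρ T hmem))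
  have iu : Integrable (fun x => u T x ^ 2) :=
    (integrable_inv_one_add_sq.const_mul Cu).mono' ((cu T hmem).pow 2).aestronglyMeasurable
      (.of_forall (hCu T hmem))
  have ie : Integrable (lyapunovDensity r σ κ ρ u ω T) :=
    (integrable_inv_one_add_sq.const_mul Ce).mono' (ce T hmem).aestronglyMeasurable
      (.of_forall (hCe T hmem))
  have iz := integrable_inv_one_add_div_sq hτ
  have i2 : Integrable (fun x => ρ T x ^ 2 + u T x ^ 2) := iρ.add iu
  have hlow : (∫ x, ((1 / 2 * (1 + T) ^ σ) * (ρ T x ^ 2 + u T x ^ 2)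
      - (2 * (1 + T) ^ (-1 - σ)) * (1 + (x / (1 + T)) ^ 2)⁻¹))
      ≤ ∫ x, lyapunovDensity r σ κ ρ u ω T x := by
    refine integral_mono ((i2.const_mul _).sub (iz.const_mul _)) ie fun x => ?_
    have h := mul_le_mul_of_nonneg_left (energy_density_lower_bound (y := x / (1 + T))
      (ρ := ρ T x) (u := u T x) (ω := ω T x) hr hσ0 hσ hσm hσκ
      (show 1 ≤ 1 + T by linarith)) (show 0 ≤ (1 + T) ^ σ by positivity)
    simp only [lyapunovDensity]
    rw [show -1 - σ = σ + (-1 - 2 * σ) by ring, Real.rpow_add hτ]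
    linarith
  have hsum : (∫ x, ((1 / 2 * (1 + T) ^ σ) * (ρ T x ^ 2 + u T x ^ 2)
      - (2 * (1 + T) ^ (-1 - σ)) * (1 + (x / (1 + T)) ^ 2)⁻¹))
      = 1 / 2 * (1 + T) ^ σ * (sqL2 (ρ T) + sqL2 (u T))
        - 2 * ((1 + T) ^ (-1 - σ) * (1 + T) ^ (1 : ℝ)) * Real.pi := by
    rw [integral_sub (i2.const_mul _) (iz.const_mul _), integral_const_mul,
      integral_const_mul, integral_inv_one_add_div_sq hτ, integral_add iρ iu, Real.rpow_one]
    simp only [sqL2]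
    ring
  have hone : (1 + T) ^ (-1 - σ) * (1 + T) ^ (1 : ℝ) ≤ 1 := by
    rw [← Real.rpow_add hτ]
    exact Real.rpow_le_one_of_one_le_of_nonpos (by linarith) (by linarith)
  have := mul_le_mul_of_nonneg_right hone Real.pi_pos.le
  linarith

/-- A smooth profile increasing from `0` at `-∞` to `1` at `+∞`. -/
def smoothStep (y : ℝ) : ℝ := (1 + y / √(1 + y ^ 2)) / 2

/-- The derivative of `smoothStep`. -/
def smoothBump (y : ℝ) : ℝ := ((1 + y ^ 2) * √(1 + y ^ 2))⁻¹ / 2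

theorem hasDerivAt_smoothStep (y : ℝ) : HasDerivAt smoothStep (smoothBump y) y := by
  have hy : 0 < 1 + y ^ 2 := by positivity
  have hs : √(1 + y ^ 2) ≠ 0 := (Real.sqrt_pos.2 hy).ne'
  have hq : √(1 + y ^ 2) ^ 2 = 1 + y ^ 2 := Real.sq_sqrt hy.le
  have h := ((((hasDerivAt_id y).div ((((hasDerivAt_id y).pow 2).const_add 1).sqrt hy.ne') hs
    ).const_add 1).div_const 2)
  refine h.congr_deriv ?_
  simp only [smoothBump, id, Pi.pow_apply, Nat.cast_ofNat, Nat.reduceSub, pow_one, mul_one, one_mul]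
  rw [hq]
  field_simp
  rw [hq]
  ring

theorem continuous_smoothBump : Continuous smoothBump := by
  unfold smoothBump
  exact (Continuous.inv₀ (by fun_prop) fun y => by positivity).div_const 2

theorem smoothBump_nonneg (y : ℝ) : 0 ≤ smoothBump y := by
  unfold smoothBump
  positivity

theorem smoothBump_le (y : ℝ) : smoothBump y ≤ (1 + y ^ 2)⁻¹ := by
  have hs : 1 ≤ √(1 + y ^ 2) := Real.one_le_sqrt.2 (by nlinarith [sq_nonneg y])
  have h : ((1 + y ^ 2) * √(1 + y ^ 2))⁻¹ ≤ (1 + y ^ 2)⁻¹ :=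
    inv_anti₀ (by positivity) (le_mul_of_one_le_right (by positivity) hs)
  have : 0 ≤ ((1 + y ^ 2) * √(1 + y ^ 2))⁻¹ := by positivity
  unfold smoothBump
  linarith

theorem abs_mul_smoothBump_le (y : ℝ) : |y| * smoothBump y ≤ (1 + y ^ 2)⁻¹ := by
  have hs : |y| ≤ √(1 + y ^ 2) := by
    rw [← Real.sqrt_sq_eq_abs]
    exact Real.sqrt_le_sqrt (by linarith)
  have hp : 0 < √(1 + y ^ 2) := Real.sqrt_pos.2 (by positivity)
  unfold smoothBump
  rw [mul_inv, mul_div_assoc, ← mul_assoc, mul_comm |y|, mul_assoc]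
  refine mul_le_of_le_one_right (by positivity) ?_
  rw [← mul_div_assoc, ← div_eq_mul_inv]
  have := (div_le_one hp).2 hs
  linarith

theorem inv_sq_le_smoothBump (y : ℝ) : ((1 + y ^ 2) ^ 2)⁻¹ ≤ 2 * smoothBump y := by
  have hs : √(1 + y ^ 2) ≤ 1 + y ^ 2 := by
    rw [Real.sqrt_le_left (by positivity)]
    nlinarith [sq_nonneg y]
  unfold smoothBump
  rw [mul_div_cancel₀ _ two_ne_zero, pow_two]
  exact inv_anti₀ (by positivity) (mul_le_mul_of_nonneg_left hs (by positivity))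

theorem smoothStep_neg (y : ℝ) : smoothStep (-y) = 1 - smoothStep y := by
  simp only [smoothStep, neg_sq, neg_div]
  ring

theorem smoothStep_nonneg (y : ℝ) : 0 ≤ smoothStep y := by
  have hp : 0 < √(1 + y ^ 2) := Real.sqrt_pos.2 (by positivity)
  have hs : |y| ≤ √(1 + y ^ 2) := by
    rw [← Real.sqrt_sq_eq_abs]
    exact Real.sqrt_le_sqrt (by linarith)
  have : -1 ≤ y / √(1 + y ^ 2) := by
    rw [le_div_iff₀ hp]
    linarith [neg_abs_le y]
  unfold smoothStep
  linarith

theorem smoothStep_le_of_nonpos {y : ℝ} (hy : y ≤ 0) : smoothStep y ≤ (1 + y ^ 2)⁻¹ := by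
  have hq : 0 < 1 + y ^ 2 := by positivity
  have hp : 0 < √(1 + y ^ 2) := Real.sqrt_pos.2 hq
  have hsq : √(1 + y ^ 2) ^ 2 = 1 + y ^ 2 := Real.sq_sqrt hq.le
  rw [← hsq]
  unfold smoothStep
  generalize √(1 + y ^ 2) = s at *
  have h1 : 1 = (s - y) * (s + y) := by linarith
  have h2 : 0 < s - y := by linarith
  have h3 : s + y = (s - y)⁻¹ := eq_inv_of_mul_eq_one_right h1.symm
  have h4 : (1 + y / s) / 2 = ((s - y) * s * 2)⁻¹ := by
    rw [mul_inv, mul_inv, ← h3]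
    field_simp
  rw [h4]
  exact inv_anti₀ (by positivity) (by nlinarith)

theorem tendsto_inv_one_add_sq_cocompact :
    Filter.Tendsto (fun x : ℝ => (1 + x ^ 2)⁻¹) (Filter.cocompact ℝ) (nhds 0) :=
  tendsto_cocompact_of_bound (C := 1) fun x => by
    rw [one_mul, Real.norm_of_nonneg (by positivity)]

theorem tendsto_smoothStep_atBot : Filter.Tendsto smoothStep Filter.atBot (nhds 0) :=
  squeeze_zero' (.of_forall smoothStep_nonneg)
    ((Filter.eventually_le_atBot 0).mono fun _ => smoothStep_le_of_nonpos)
    (tendsto_inv_one_add_sq_cocompact.mono_left _root_.atBot_le_cocompact)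

theorem tendsto_smoothStep_atTop : Filter.Tendsto smoothStep Filter.atTop (nhds 1) := by
  have h := (tendsto_smoothStep_atBot.comp Filter.tendsto_neg_atTop_atBot).const_sub 1
  simpa [Function.comp_def, smoothStep_neg] using h

theorem integrable_smoothBump : Integrable smoothBump :=
  integrable_inv_one_add_sq.mono' continuous_smoothBump.aestronglyMeasurable
    (.of_forall fun x => by
      rw [Real.norm_of_nonneg (smoothBump_nonneg x)]
      exact smoothBump_le x)

theorem exists_primitive_of_le_smoothBump {f : ℝ → ℝ} (hf : Continuous f) {C : ℝ}
    (hC : ∀ x, |f x| ≤ C * smoothBump x) :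
    ∃ (M : ℝ) (W : ℝ → ℝ), (∀ x, HasDerivAt W (f x) x) ∧
      (∀ x, |W x| ≤ C * smoothStep x) ∧ ∀ x, |M - W x| ≤ C * (1 - smoothStep x) := by
  have hi : Integrable f := (integrable_smoothBump.const_mul C).mono' hf.aestronglyMeasurable
    (.of_forall hC)
  refine ⟨∫ x, f x, fun x => ∫ y in Set.Iic x, f y, fun x => ?_, fun x => ?_, fun x => ?_⟩
  · have h := ((hf.integral_hasStrictDerivAt 0 x).hasDerivAt).const_add (∫ y in Set.Iic 0, f y)
    refine h.congr_of_eventuallyEq (.of_forall fun y => ?_)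
    simp only
    rw [← intervalIntegral.integral_Iic_sub_Iic hi.integrableOn hi.integrableOn]
    ring
  · have h := integral_Iic_of_hasDerivAt_of_tendsto' (a := x) (fun y _ => hasDerivAt_smoothStep y)
      integrable_smoothBump.integrableOn tendsto_smoothStep_atBot
    rw [sub_zero] at h
    rw [← h, ← integral_const_mul]
    exact norm_integral_le_of_norm_le (f := f) (integrable_smoothBump.const_mul C).integrableOn
      (.of_forall hC)
  · have h := integral_Ioi_of_hasDerivAt_of_tendsto' (a := x) (fun y _ => hasDerivAt_smoothStep y)
      integrable_smoothBump.integrableOn tendsto_smoothStep_atTop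
    rw [← intervalIntegral.integral_Iic_add_Ioi (b := x) hi.integrableOn hi.integrableOn,
      add_sub_cancel_left, ← h, ← integral_const_mul]
    exact norm_integral_le_of_norm_le (f := f) (integrable_smoothBump.const_mul C).integrableOn
      (.of_forall hC)

theorem unifDecay_sub_smoothStep {T C M : ℝ} {W : ℝ → ℝ} (h0 : ∀ x, |W x| ≤ C * smoothStep x)
    (h1 : ∀ x, |M - W x| ≤ C * (1 - smoothStep x)) :
    UnifDecay T 1 (fun t x => W x - M * smoothStep (x / (1 + t))) := by
  have hC : 0 ≤ C := by
    have h2 := abs_nonneg (W 0) |>.trans (h0 0)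
    have h3 := abs_nonneg (M - W 0) |>.trans (h1 0)
    linarith
  refine ⟨C + |M| * (1 + T) ^ 2, fun t ht x => ?_⟩
  rw [Real.rpow_neg_one]
  have hτ : 1 ≤ 1 + t := by linarith [ht.1]
  have hscale : (1 + (x / (1 + t)) ^ 2)⁻¹ ≤ (1 + T) ^ 2 * (1 + x ^ 2)⁻¹ := by
    rw [← div_eq_mul_inv, le_div_iff₀ (by positivity), inv_mul_le_iff₀ (by positivity), div_pow]
    have h2 : (1 + t) ^ 2 ≤ (1 + T) ^ 2 := pow_le_pow_left₀ (by linarith) (by linarith [ht.2]) 2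
    have h3 : 1 ≤ (1 + t) ^ 2 := one_le_pow₀ hτ
    have h4 : x ^ 2 = x ^ 2 / (1 + t) ^ 2 * (1 + t) ^ 2 := by field_simp
    have h5 : 0 ≤ x ^ 2 / (1 + t) ^ 2 := by positivity
    nlinarith
  have key {z : ℝ} (hz : z ≤ 0) (hz2 : z ^ 2 = x ^ 2) :
      C * smoothStep z + |M| * smoothStep (z / (1 + t))
        ≤ (C + |M| * (1 + T) ^ 2) * (1 + x ^ 2)⁻¹ := by
    have h2 := smoothStep_le_of_nonpos hz
    have h3 := smoothStep_le_of_nonpos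
      (div_nonpos_of_nonpos_of_nonneg hz (show 0 ≤ 1 + t by linarith))
    rw [hz2] at h2
    rw [div_pow, hz2, ← div_pow] at h3
    have h4 := mul_le_mul_of_nonneg_left h2 hC
    have h5 := mul_le_mul_of_nonneg_left (h3.trans hscale) (abs_nonneg M)
    linarith
  rcases le_total x 0 with hx | hx
  · refine le_trans ?_ (key hx rfl)
    refine (abs_sub _ _).trans (add_le_add (h0 x) ?_)
    rw [abs_mul, abs_of_nonneg (smoothStep_nonneg _)]
  · refine le_trans ?_ (key (neg_nonpos.2 hx) (neg_sq x))
    beta_reduce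
    rw [neg_div, smoothStep_neg, smoothStep_neg,
      show W x - M * smoothStep (x / (1 + t))
        = M * (1 - smoothStep (x / (1 + t))) - (M - W x) by ring]
    refine (abs_sub _ _).trans ?_
    rw [add_comm, abs_mul, ← smoothStep_neg (x / (1 + t)), abs_of_nonneg (smoothStep_nonneg _)]
    exact add_le_add_left (h1 x) _

theorem UnifDecay.integral {T : ℝ} {g : ℝ → ℝ → ℝ} (hg : UnifDecay T 1 g) :
    UnifDecay T 1 (fun t x => ∫ s in (0 : ℝ)..t, g s x) := by
  obtain ⟨C, hC⟩ := hg
  refine ⟨C * T, fun t ht x => ?_⟩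
  have h := intervalIntegral.norm_integral_le_of_norm_le_const (a := 0) (b := t)
    (f := fun s => g s x) (C := C * (1 + x ^ 2) ^ (-1 : ℝ)) fun s hs => by
      rw [Set.uIoc_of_le ht.1] at hs
      exact hC s ⟨hs.1.le, hs.2.trans ht.2⟩ x
  rw [sub_zero, abs_of_nonneg ht.1] at h
  have h0 : 0 ≤ C * (1 + x ^ 2) ^ (-1 : ℝ) := (abs_nonneg _).trans (hC t ht x)
  refine h.trans ((mul_le_mul_of_nonneg_left ht.2 h0).trans_eq (by ring))

theorem UnifDecay.of_moments {T : ℝ} {g : ℝ → ℝ → ℝ}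
    (hg : ∀ k : ℕ, ∃ C, ∀ t ∈ Set.Icc 0 T, ∀ x, |x| ^ k * |g t x| ≤ C) : UnifDecay T 2 g := by
  obtain ⟨C, hC⟩ := hg 0
  obtain ⟨D, hD⟩ := hg 4
  refine ⟨2 * (C + D), fun t ht x => ?_⟩
  have h0 := hC t ht x
  have h4 := hD t ht x
  rw [pow_zero, one_mul] at h0
  rw [Real.rpow_neg (by positivity), ← div_eq_mul_inv, le_div_iff₀ (by positivity), Real.rpow_two]
  rw [show |x| ^ 4 = (x ^ 2) ^ 2 by rw [← sq_abs x]; ring] at h4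
  nlinarith [mul_nonneg (abs_nonneg (g t x)) (sq_nonneg (x ^ 2 - 1))]

namespace IsPSystemSolution

variable {r T : ℝ} {ρ u : ℝ → ℝ → ℝ}

theorem contDiff_time_rho (h : IsPSystemSolution r ρ u) (x : ℝ) :
    ContDiff ℝ (⊤ : ℕ∞) (fun s => ρ s x) :=
  h.smooth_rho.comp (contDiff_id.prodMk contDiff_const)

theorem contDiff_time_u (h : IsPSystemSolution r ρ u) (x : ℝ) :
    ContDiff ℝ (⊤ : ℕ∞) (fun s => u s x) :=
  h.smooth_u.comp (contDiff_id.prodMk contDiff_const)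

theorem contDiff_rho (h : IsPSystemSolution r ρ u) (t : ℝ) : ContDiff ℝ (⊤ : ℕ∞) (ρ t) :=
  h.smooth_rho.comp (contDiff_const.prodMk contDiff_id)

theorem contDiff_u (h : IsPSystemSolution r ρ u) (t : ℝ) : ContDiff ℝ (⊤ : ℕ∞) (u t) :=
  h.smooth_u.comp (contDiff_const.prodMk contDiff_id)

theorem hasDerivAt_rho (h : IsPSystemSolution r ρ u) (t x : ℝ) :
    HasDerivAt (ρ t) (deriv (ρ t) x) x :=
  ((h.contDiff_rho t).differentiable (by simp)).differentiableAt.hasDerivAt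

theorem hasDerivAt_u (h : IsPSystemSolution r ρ u) (t x : ℝ) :
    HasDerivAt (u t) (deriv (u t) x) x :=
  ((h.contDiff_u t).differentiable (by simp)).differentiableAt.hasDerivAt

theorem hasDerivAt_time_rho (h : IsPSystemSolution r ρ u) {t : ℝ} (ht : 0 ≤ t) (x : ℝ) :
    HasDerivAt (fun s => ρ s x) (-deriv (u t) x) t :=
  ((h.contDiff_time_rho x).differentiable (by simp)).differentiableAt.hasDerivAt.congr_deriv
    (eq_neg_of_add_eq_zero_left (h.eq1 t x ht))

theorem hasDerivAt_time_u (h : IsPSystemSolution r ρ u) {t : ℝ} (ht : 0 ≤ t) (x : ℝ) :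
    HasDerivAt (fun s => u s x) (-deriv (ρ t) x - |u t x| ^ (r - 1) * u t x) t :=
  ((h.contDiff_time_u x).differentiable (by simp)).differentiableAt.hasDerivAt.congr_deriv
    (by linarith [h.eq2 t x ht])

theorem unifDecay_iteratedDeriv (h : IsPSystemSolution r ρ u) (m : ℕ) :
    UnifDecay T 2 (fun t => iteratedDeriv m (ρ t)) ∧
      UnifDecay T 2 (fun t => iteratedDeriv m (u t)) := by
  constructor
  all_goals
    refine UnifDecay.of_moments fun k => ?_
    obtain ⟨C, hC⟩ := h.decay k m T
    refine ⟨C, fun t ht x => le_trans ?_ (hC t ht x)⟩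
    gcongr
  · exact le_add_of_nonneg_right (abs_nonneg _)
  · exact le_add_of_nonneg_left (abs_nonneg _)

theorem unifDecay_rho (h : IsPSystemSolution r ρ u) : UnifDecay T 2 ρ := by
  simpa only [iteratedDeriv_zero] using (h.unifDecay_iteratedDeriv (T := T) 0).1

theorem unifDecay_u (h : IsPSystemSolution r ρ u) : UnifDecay T 2 u := by
  simpa only [iteratedDeriv_zero] using (h.unifDecay_iteratedDeriv (T := T) 0).2

theorem unifDecay_deriv_rho (h : IsPSystemSolution r ρ u) :
    UnifDecay T 2 (fun t => deriv (ρ t)) := by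
  simpa only [iteratedDeriv_one] using (h.unifDecay_iteratedDeriv (T := T) 1).1

theorem unifDecay_deriv_u (h : IsPSystemSolution r ρ u) :
    UnifDecay T 2 (fun t => deriv (u t)) := by
  simpa only [iteratedDeriv_one] using (h.unifDecay_iteratedDeriv (T := T) 1).2

theorem hasDerivAt_integral_u (h : IsPSystemSolution r ρ u) {t : ℝ} (ht : 0 ≤ t) (x : ℝ) :
    HasDerivAt (fun y => ∫ s in (0 : ℝ)..t, u s y) (ρ 0 x - ρ t x) x := by
  obtain ⟨C, hC⟩ := h.decay 0 1 t
  have hmem {s : ℝ} (hs : s ∈ Set.uIoc 0 t) : s ∈ Set.Icc 0 t := by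
    rw [Set.uIoc_of_le ht] at hs
    exact ⟨hs.1.le, hs.2⟩
  have hc : Continuous (deriv fun s => ρ s x) := (h.contDiff_time_rho x).continuous_deriv (by simp)
  have hd {s : ℝ} (hs : s ∈ Set.uIoc 0 t) (y : ℝ) :
      -deriv (fun s => ρ s y) s = deriv (u s) y := by
    linarith [h.eq1 s y (hmem hs).1]
  have key := (intervalIntegral.hasDerivAt_integral_of_dominated_loc_of_deriv_le (𝕜 := ℝ)
    (μ := volume) (a := 0) (b := t) (F := fun y s => u s y)
    (F' := fun y s => -deriv (fun s => ρ s y) s) (bound := fun _ => C) (x₀ := x)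
    (s := Set.univ) Filter.univ_mem
    (.of_forall fun y => (h.contDiff_time_u y).continuous.aestronglyMeasurable)
    ((h.contDiff_time_u x).continuous.intervalIntegrable 0 t)
    hc.neg.aestronglyMeasurable
    (.of_forall fun s hs y _ => by
      have h1 := hC s (hmem hs) y
      simp only [pow_zero, one_mul, iteratedDeriv_one] at h1
      rw [hd hs, Real.norm_eq_abs]
      exact (le_add_of_nonneg_left (abs_nonneg _)).trans h1)
    intervalIntegrable_const
    (.of_forall fun s hs y _ => by
      simp only [hd hs]
      exact h.hasDerivAt_u s y)).2
  refine key.congr_deriv ?_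
  rw [intervalIntegral.integral_neg, intervalIntegral.integral_deriv_eq_sub' _ rfl
    (fun s _ => ((h.contDiff_time_rho x).differentiable (by simp)).differentiableAt)
    hc.continuousOn]
  ring

/-- Schwartz data have algebraically decaying energy: the potential `w` with `∂ₓw = ρ - a` and
`∂ₜw = -u + b`, for self-similar `a` and `b` carrying the mass of `ρ`, closes the weighted energy
estimate. -/
theorem exists_rpow_decay (h : IsPSystemSolution r ρ u) (hr₁ : 1 < r) (hr₂ : r < 3) :
    ∃ σ C : ℝ, 0 < σ ∧ ∀ t, 0 ≤ t → sqL2 (ρ t) + sqL2 (u t) ≤ C * (1 + t) ^ (-σ) := by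
  have hr : 0 < r - 1 := by linarith
  set κ := ((r + 1) * (8 * (r + 1)) ^ r)⁻¹
  have hκ0 : 0 < κ := by positivity
  have hκ : κ * ((r + 1) * (8 * (r + 1)) ^ r) ≤ 1 := (inv_mul_cancel₀ (by positivity)).le
  have hgap : 0 < (2 / (r - 1) - 1) / 2 := by
    have : 1 < 2 / (r - 1) := (one_lt_div hr).2 (by linarith)
    linarith
  obtain ⟨σ, hσ0, hσ, hσκ, hσm, hσr⟩ : ∃ σ : ℝ, 0 < σ ∧ σ ≤ 1 / 16 ∧ σ ≤ κ / 32 ∧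
      σ ≤ (2 / (r - 1) - 1) / 2 ∧ σ ≤ (r - 1) / 2 := by
    refine ⟨min (min (1 / 16) (κ / 32)) (min ((2 / (r - 1) - 1) / 2) ((r - 1) / 2)), ?_,
      (min_le_left _ _).trans (min_le_left _ _), (min_le_left _ _).trans (min_le_right _ _),
      (min_le_right _ _).trans (min_le_left _ _), (min_le_right _ _).trans (min_le_right _ _)⟩
    exact lt_min (lt_min (by norm_num) (by positivity)) (lt_min hgap (by positivity))
  obtain ⟨C₀, hC₀⟩ := h.unifDecay_rho (T := 0)
  have hρ₀ (x : ℝ) : |ρ 0 x| ≤ (2 * |C₀|) * smoothBump x := by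
    refine (hC₀ 0 (Set.left_mem_Icc.2 le_rfl) x).trans ?_
    rw [Real.rpow_neg (by positivity), Real.rpow_two, mul_comm 2, mul_assoc]
    exact mul_le_mul (le_abs_self _) (inv_sq_le_smoothBump x) (by positivity) (abs_nonneg _)
  obtain ⟨M, W, hW, hW0, hW1⟩ := exists_primitive_of_le_smoothBump (h.contDiff_rho 0).continuous hρ₀
  set ω : ℝ → ℝ → ℝ := fun t x =>
    (W x - M * smoothStep (x / (1 + t)) - ∫ s in (0 : ℝ)..t, u s x) * (1 + t)⁻¹ with hωdef
  set a : ℝ → ℝ → ℝ := fun t x => M * (1 + t)⁻¹ * smoothBump (x / (1 + t)) with hadef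
  set b : ℝ → ℝ → ℝ := fun t x =>
    M * (1 + t)⁻¹ * (x / (1 + t) * smoothBump (x / (1 + t))) with hbdef
  have ha {t : ℝ} (ht : 0 ≤ t) (x : ℝ) :
      |a t x| ≤ |M| * (1 + t)⁻¹ * (1 + (x / (1 + t)) ^ 2)⁻¹ := by
    have hτ : 0 ≤ (1 + t)⁻¹ := by positivity
    rw [hadef]
    simp only [abs_mul, abs_of_nonneg hτ, abs_of_nonneg (smoothBump_nonneg _)]
    exact mul_le_mul_of_nonneg_left (smoothBump_le _) (by positivity)
  have hb {t : ℝ} (ht : 0 ≤ t) (x : ℝ) :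
      |b t x| ≤ |M| * (1 + t)⁻¹ * (1 + (x / (1 + t)) ^ 2)⁻¹ := by
    have hτ : 0 ≤ (1 + t)⁻¹ := by positivity
    rw [hbdef]
    simp only [abs_mul, abs_of_nonneg hτ, abs_of_nonneg (smoothBump_nonneg _)]
    exact mul_le_mul_of_nonneg_left (abs_mul_smoothBump_le _) (by positivity)
  have hωx {t : ℝ} (ht : 0 ≤ t) (x : ℝ) :
      HasDerivAt (ω t) ((ρ t x - a t x) * (1 + t)⁻¹) x := by
    have h1 := (hasDerivAt_smoothStep (x / (1 + t))).comp x ((hasDerivAt_id x).div_const (1 + t))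
    have h2 := (((hW x).sub (h1.const_mul M)).sub (h.hasDerivAt_integral_u ht x)).mul_const
      (1 + t)⁻¹
    refine h2.congr_deriv ?_
    simp only [hadef]
    ring
  have hωt {t : ℝ} (ht : 0 ≤ t) (x : ℝ) :
      HasDerivAt (fun s => ω s x) ((-u t x + b t x - ω t x) * (1 + t)⁻¹) t := by
    have hτ : 1 + t ≠ 0 := by positivity
    have h0 : HasDerivAt (fun s : ℝ => 1 + s) 1 t := (hasDerivAt_id t).const_add 1
    have h1 := (hasDerivAt_smoothStep (x / (1 + t))).comp t ((hasDerivAt_const t x).div h0 hτ)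
    have h2 := ((h.contDiff_time_u x).continuous.integral_hasStrictDerivAt 0 t).hasDerivAt
    have h3 := (((h1.const_mul M).const_sub (W x)).sub h2).mul (h0.inv hτ)
    refine h3.congr_deriv ?_
    simp only [hbdef, hωdef, Function.comp_apply, Pi.sub_apply, Pi.div_apply, Pi.inv_apply]
    field_simp
    ring
  set K := (∫ x, lyapunovDensity r σ κ ρ u ω 0 x)
    + (|M| ^ 2 + 16 + |M| ^ (r + 1)) * Real.pi / σ + 2 * Real.pi with hK
  refine ⟨σ, 2 * K, hσ0, fun T hT => ?_⟩
  have dM (n : ℝ → ℝ → ℝ) (hn : ∀ t ∈ Set.Icc 0 T, ∀ x,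
      |n t x| ≤ |M| * (1 + t)⁻¹ * (1 + (x / (1 + t)) ^ 2)⁻¹) : UnifDecay T 1 n := by
    refine ⟨|M| * (1 + T), fun t ht x => (hn t ht x).trans ?_⟩
    have h0 : 1 ≤ 1 + t := by linarith [ht.1]
    rw [Real.rpow_neg_one, mul_assoc, mul_assoc]
    refine mul_le_mul_of_nonneg_left ?_ (abs_nonneg M)
    rw [← mul_inv, ← div_eq_mul_inv, le_div_iff₀ (by positivity),
      inv_mul_le_iff₀ (by positivity), div_pow]
    have h1 : (1 + t) * (1 + x ^ 2 / (1 + t) ^ 2) * (1 + T)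
        = (1 + T) * (1 + t) + x ^ 2 * ((1 + T) / (1 + t)) := by field_simp
    have h2 : 1 ≤ (1 + T) / (1 + t) := (one_le_div (by linarith)).2 (by linarith [ht.2])
    rw [h1]
    nlinarith [mul_nonneg (sq_nonneg x) (sub_nonneg.2 h2), mul_nonneg hT ht.1, ht.1]
  have key := weighted_energy_bound (ρ := ρ) (u := u) (ω := ω) (a := a) (b := b)
    (ρx := fun t => deriv (ρ t)) (ux := fun t => deriv (u t)) hr₁ hσ0 hσ (by linarith)
    (by linarith) hκ0 hκ (by linarith) (abs_nonneg M) hT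
    (fun t ht => h.hasDerivAt_time_rho ht.1) (fun t ht => h.hasDerivAt_time_u ht.1)
    (fun t ht => hωt ht.1) (fun t _ => h.hasDerivAt_rho t) (fun t _ => h.hasDerivAt_u t)
    (fun t ht => hωx ht.1)
    (fun t _ => (h.contDiff_rho t).continuous_deriv (by simp))
    (fun t _ => (h.contDiff_u t).continuous_deriv (by simp))
    (fun t _ => by
      have := continuous_smoothBump
      simp only [hadef]
      fun_prop)
    (fun t _ => by
      have := continuous_smoothBump
      simp only [hbdef]
      fun_prop)
    (h.unifDecay_rho.mono (by norm_num)) (h.unifDecay_u.mono (by norm_num))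
    (by simpa only [add_zero] using ((unifDecay_sub_smoothStep hW0 hW1).sub
      (h.unifDecay_u.mono (by norm_num)).integral).mul UnifDecay.time_inv)
    (h.unifDecay_deriv_rho.mono (by norm_num)) (h.unifDecay_deriv_u.mono (by norm_num))
    (dM a fun t ht => ha ht.1) (dM b fun t ht => hb ht.1)
    (fun t ht => ha ht.1) (fun t ht => hb ht.1)
  rw [← hK] at key
  rw [Real.rpow_neg (by positivity), ← div_eq_mul_inv, le_div_iff₀ (by positivity)]
  linarith

end IsPSystemSolution

/-- **Theorem 6, second part.** Logarithmic decay for the nonlinearly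
damped `p`-system: for `1 < r < 3`, `q > 0`, and data with `ρ₀ ∈ L¹` and
`∫ (log(1+|x|))^{2q}(|ρ₀|² + |u₀|²) < ∞`, there is `C_q > 0`, independent of time, such
that `‖(ρ,u)(t)‖_{L²} ≤ C_q / (log(1+t))^q` for all `t > 0`. -/
theorem p_system_logarithmic_decay
    (r : ℝ) (hr₁ : 1 < r) (hr₂ : r < 3) (q : ℝ) (hq : 0 < q)
    (ρ u : ℝ → ℝ → ℝ) (hsol : IsPSystemSolution r ρ u)
    (hL1 : Integrable (fun x => |ρ 0 x|))
    (hw : Integrable (fun x =>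
      (Real.log (1 + |x|)) ^ (2 * q) * ((ρ 0 x) ^ 2 + (u 0 x) ^ 2))) :
    ∃ Cq : ℝ, 0 < Cq ∧
      ∀ t : ℝ, 0 < t →
        Real.sqrt (sqL2 (ρ t) + sqL2 (u t)) ≤ Cq / (Real.log (1 + t)) ^ q := by
  obtain ⟨σ, C, hσ, hC⟩ := hsol.exists_rpow_decay hr₁ hr₂
  set ε := σ / (2 * q) with hε
  have hε0 : 0 < ε := by positivity
  refine ⟨√|C| * (ε ^ q)⁻¹ + 1, by positivity, fun t ht => ?_⟩
  have hτ : 0 < 1 + t := by linarith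
  have hlog : 0 < Real.log (1 + t) := Real.log_pos (by linarith)
  have hpow : 0 < (1 + t) ^ (σ / 2) := by positivity
  have hlogq : Real.log (1 + t) ^ q ≤ (1 + t) ^ (σ / 2) * (ε ^ q)⁻¹ := by
    have h := Real.rpow_le_rpow hlog.le (Real.log_le_rpow_div hτ.le hε0) hq.le
    rwa [Real.div_rpow (by positivity) hε0.le, ← Real.rpow_mul hτ.le, div_eq_mul_inv,
      show ε * q = σ / 2 by rw [hε]; field_simp] at h
  have hsqrt : √(sqL2 (ρ t) + sqL2 (u t)) * (1 + t) ^ (σ / 2) ≤ √|C| := by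
    rw [← Real.sqrt_sq hpow.le, ← Real.sqrt_mul' _ (sq_nonneg _)]
    refine Real.sqrt_le_sqrt ?_
    have h := mul_le_mul_of_nonneg_right (hC t ht.le) (sq_nonneg ((1 + t) ^ (σ / 2)))
    refine h.trans ?_
    rw [← Real.rpow_mul_natCast hτ.le, mul_assoc, ← Real.rpow_add hτ]
    simpa using le_abs_self C
  rw [le_div_iff₀ (by positivity)]
  calc √(sqL2 (ρ t) + sqL2 (u t)) * Real.log (1 + t) ^ q
      ≤ √(sqL2 (ρ t) + sqL2 (u t)) * ((1 + t) ^ (σ / 2) * (ε ^ q)⁻¹) := by gcongr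
    _ = √(sqL2 (ρ t) + sqL2 (u t)) * (1 + t) ^ (σ / 2) * (ε ^ q)⁻¹ := by ring
    _ ≤ √|C| * (ε ^ q)⁻¹ := by gcongr
    _ ≤ √|C| * (ε ^ q)⁻¹ + 1 := by linarith
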